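/- The language of irreducible Dyck words (nonempty words over {u, d} of total height 0 all of whose proper nonempty prefixes have height ≥ 1) over the alphabet {u, d} with involution u* = d is a Pythagorean language. -/

import Mathlib

/-- The involution on words induced by an involution `s` on letters. -/
def wordStar {G : Type*} (s : G → G) (w : List G) : List G :=
  (w.map s).reverse

/-- A language is self-adjoint if it is closed under the word involution. -/
def IsSelfAdjointLang {G : Type*} (s : G → G) (L : Set (List G)) : Prop :=
  ∀ w ∈ L, wordStar s w ∈ L

/-- A self-adjoint language `L` is Pythagorean if for all nonempty words `α, β, γ`:
whenever `β*α` and `γ*α` lie in `L`, then `α*α` and `γ*β` lie in `L`. -/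
def IsPythagorean {G : Type*} (s : G → G) (L : Set (List G)) : Prop :=
  IsSelfAdjointLang s L ∧
    ∀ α β γ : List G, α ≠ [] → β ≠ [] → γ ≠ [] →
      wordStar s β ++ α ∈ L → wordStar s γ ++ α ∈ L →
      wordStar s α ++ α ∈ L ∧ wordStar s γ ++ β ∈ L

/-- The alphabet `{u, d}` is modeled by `Bool`, with `u = true`, `d = false`;
the involution `u* = d` is boolean negation. -/
def bstar : Bool → Bool := fun b => !b

/-- The height of a word: `u` counts `+1`, `d` counts `-1`. -/
def ht (w : List Bool) : ℤ :=
  (w.map (fun b => if b then (1 : ℤ) else -1)).sum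

/-- Irreducible Dyck words: nonempty words of total height `0` all of whose proper
nonempty prefixes have height `≥ 1`. -/
def IrrDyckLang : Set (List Bool) :=
  {w | w ≠ [] ∧ ht w = 0 ∧ ∀ p : List Bool, p <+: w → p ≠ [] → p ≠ w → 1 ≤ ht p}

theorem ht_append (v w : List Bool) : ht (v ++ w) = ht v + ht w := by
  simp [ht]

theorem ht_wordStar (w : List Bool) : ht (wordStar bstar w) = -ht w := by
  induction w with
  | nil => simp [ht, wordStar]
  | cons a w ih =>
    have h₁ : wordStar bstar (a :: w) = wordStar bstar w ++ [bstar a] := by simp [wordStar]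
    have h₂ : ht (a :: w) = ht [a] + ht w := ht_append [a] w
    have h₃ : ht [bstar a] = -ht [a] := by cases a <;> simp [ht, bstar]
    rw [h₁, ht_append, ih, h₂, h₃]
    ring

theorem wordStar_append {G : Type*} (s : G → G) (v w : List G) :
    wordStar s (v ++ w) = wordStar s w ++ wordStar s v := by
  simp [wordStar]

theorem wordStar_wordStar (w : List Bool) : wordStar bstar (wordStar bstar w) = w := by
  simp [wordStar, bstar, Function.comp_def]

theorem wordStar_eq_nil {G : Type*} (s : G → G) (w : List G) :
    wordStar s w = [] ↔ w = [] := by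
  simp [wordStar]

/-- The words all of whose nonempty suffixes have negative height. -/
def HasNegSuffixes (w : List Bool) : Prop :=
  ∀ s : List Bool, s <:+ w → s ≠ [] → ht s ≤ -1

theorem wordStar_append_mem_irrDyckLang {α β : List Bool} (hα : α ≠ []) (hβ : β ≠ []) :
    wordStar bstar β ++ α ∈ IrrDyckLang ↔
      ht α = ht β ∧ HasNegSuffixes α ∧ HasNegSuffixes β := by
  constructor
  · rintro ⟨-, h0, hp⟩
    rw [ht_append, ht_wordStar] at h0
    refine ⟨by linarith, ?_, ?_⟩
    · rintro s ⟨t, rfl⟩ hs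
      have h := hp (wordStar bstar β ++ t) ⟨s, by simp⟩ (by simp [wordStar_eq_nil, hβ])
        (by simpa using hs)
      rw [ht_append, ht_wordStar] at h
      rw [ht_append] at h0
      linarith
    · rintro s ⟨t, rfl⟩ hs
      have h := hp (wordStar bstar s) ⟨wordStar bstar t ++ α, by simp [wordStar_append]⟩
        (by simpa [wordStar_eq_nil] using hs) (by simp [wordStar_append, hα])
      rw [ht_wordStar] at h
      linarith
  · rintro ⟨h0, hα', hβ'⟩
    refine ⟨by simp [hα], by rw [ht_append, ht_wordStar]; linarith, ?_⟩
    rintro p ⟨s, hs⟩ hne hpw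
    rcases List.append_eq_append_iff.mp hs with ⟨q, hq, -⟩ | ⟨t, rfl, rfl⟩
    · have hβq : β = wordStar bstar q ++ wordStar bstar p := by
        rw [← wordStar_append, ← hq, wordStar_wordStar]
      have h := hβ' (wordStar bstar p) ⟨wordStar bstar q, hβq.symm⟩
        (by simpa [wordStar_eq_nil] using hne)
      rw [ht_wordStar] at h
      linarith
    · have h := hα' s ⟨t, rfl⟩ (by rintro rfl; simp at hpw)
      rw [ht_append] at h0
      rw [ht_append, ht_wordStar]
      linarith

theorem isSelfAdjointLang_irrDyckLang : IsSelfAdjointLang bstar IrrDyckLang := by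
  rintro w ⟨hw, h0, hp⟩
  refine ⟨by simpa [wordStar_eq_nil] using hw, by rw [ht_wordStar, h0, neg_zero], ?_⟩
  rintro p ⟨q, hq⟩ hne hpw
  have hwq : w = wordStar bstar q ++ wordStar bstar p := by
    rw [← wordStar_append, hq, wordStar_wordStar]
  have hq' : q ≠ [] := by
    rintro rfl
    exact hpw (by simpa using hq)
  have h := hp (wordStar bstar q) ⟨_, hwq.symm⟩ (by simpa [wordStar_eq_nil] using hq')
    (by simpa [hwq, wordStar_eq_nil] using hne)
  rw [hwq, ht_append, ht_wordStar p] at h0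
  linarith

/-- The language of irreducible Dyck words is Pythagorean. -/
theorem irrDyck_isPythagorean : IsPythagorean bstar IrrDyckLang := by
  refine ⟨isSelfAdjointLang_irrDyckLang, fun α β γ hα hβ hγ h₁ h₂ => ?_⟩
  rw [wordStar_append_mem_irrDyckLang hα hβ] at h₁
  rw [wordStar_append_mem_irrDyckLang hα hγ] at h₂
  rw [wordStar_append_mem_irrDyckLang hα hα, wordStar_append_mem_irrDyckLang hβ hγ]
  exact ⟨⟨rfl, h₁.2.1, h₁.2.1⟩, h₁.1.symm.trans h₂.1, h₁.2.2, h₂.2.2⟩
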